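/- Let (α,β) ∈ P × P̄. (i) If (α,β) is right extremal, then Σ_{(α,β)} = Σ_{(α, ξ_α(β))}. (ii) If (α,β) is left extremal, then Σ_{(α,β)} = Σ_{(ξ'_β(α), β)}. -/

import Mathlib

open Filter MeasureTheory

namespace DoublingHole

/-- One-sided binary sequences (indexed from 0, corresponding to x₁x₂x₃⋯). -/
abbrev Seq : Type := ℕ → Bool

/-- The one-sided shift map σ. -/
def shift (x : Seq) : Seq := fun n => x (n + 1)

/-- Strict lexicographic order ≺ on sequences. -/
def lexLt (x y : Seq) : Prop := ∃ k : ℕ, (∀ i, i < k → x i = y i) ∧ x k < y k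

/-- Reflexive lexicographic order ≼ on sequences. -/
def lexLe (x y : Seq) : Prop := lexLt x y ∨ x = y

/-- The lexicographic subshift Σ_{(α,β)} = {x : β ≼ σⁿx ≼ α for all n ≥ 0}. -/
def lexSubshift (α β : Seq) : Set Seq :=
  {x | ∀ n : ℕ, lexLe β (shift^[n] x) ∧ lexLe (shift^[n] x) α}

/-- The projection π : Σ₂ → [0,1], π(x) = Σ xᵢ 2^{-i}. -/
noncomputable def piMap (x : Seq) : ℝ := ∑' i : ℕ, if x i then (1 : ℝ) / 2 ^ (i + 1) else 0

/-- The mirror image x̄ of a sequence. -/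
def mirror (x : Seq) : Seq := fun n => !(x n)

/-- The set P of Parry sequences: α₁ = 1 and σⁿα ≼ α for all n ≥ 1. -/
def ParryP : Set Seq := {α | α 0 = true ∧ ∀ n, 1 ≤ n → lexLe (shift^[n] α) α}

/-- The set P̄ of mirror images of Parry sequences. -/
def barP : Set Seq := {β | mirror β ∈ ParryP}

/-- Periodic sequences. -/
def PerSet : Set Seq := {x | ∃ k, 1 ≤ k ∧ shift^[k] x = x}

/-- Membership in the lexicographic world LW. -/
def inLW (α β : Seq) : Prop :=
  α ∈ ParryP ∧ β ∈ barP ∧ ∀ n, 1 ≤ n → lexLe β (shift^[n] α) ∧ lexLe (shift^[n] β) α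

/-- The doubling map x ↦ 2x (mod 1) on S¹ identified with [0,1). -/
noncomputable def dbl (x : ℝ) : ℝ := Int.fract (2 * x)

/-- The exceptional set X_{(a,b)} of points whose orbit avoids the hole (a,b). -/
def Xset (a b : ℝ) : Set ℝ :=
  {x | x ∈ Set.Ico (0 : ℝ) 1 ∧ ∀ n : ℕ, dbl^[n] x ∉ Set.Ioo a b}

/-- The attractor Λ_{(a,b)} = [2b-1, 2a] ∩ X_{(a,b)}. -/
def Lam (a b : ℝ) : Set ℝ := Set.Icc (2 * b - 1) (2 * a) ∩ Xset a b

/-- χ(a) = sup{b : X_{(a,b)} is uncountable}. -/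
noncomputable def chiFn (a : ℝ) : ℝ :=
  sSup {b | b ∈ Set.Ico (0 : ℝ) 1 ∧ ¬ (Xset a b).Countable}

/-- The parameter region D₁. -/
def D1 : Set (ℝ × ℝ) :=
  {p | p.1 ∈ Set.Ioo (1/4 : ℝ) (1/2) ∧ p.2 ∈ Set.Ioo (1/2 : ℝ) (3/4) ∧ p.2 ≤ chiFn p.1}

/-- The set S of parameters whose endpoints both fall into the hole. -/
def Sset : Set (ℝ × ℝ) :=
  {p | p ∈ D1 ∧ (∃ n, 1 ≤ n ∧ dbl^[n] p.1 ∈ Set.Ioo p.1 p.2) ∧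
        ∃ m, 1 ≤ m ∧ dbl^[m] p.2 ∈ Set.Ioo p.1 p.2}

/-- The finite word w occurs in (is a factor of) the sequence x. -/
def occursIn (w : List Bool) (x : Seq) : Prop :=
  ∃ i : ℕ, w = List.ofFn fun j : Fin w.length => x (i + (j : ℕ))

/-- The language of a subshift: all finite factors of its elements. -/
def Lang (A : Set Seq) : Set (List Bool) := {w | ∃ x ∈ A, occursIn w x}

/-- A set of sequences is a subshift of finite type if it is defined by
finitely many forbidden words. -/
def IsSFT (A : Set Seq) : Prop :=
  ∃ F : Finset (List Bool), A = {x | ∀ w ∈ F, ¬ occursIn w x}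

/-- B_n(A): the admissible words of length n. -/
def wordsOfLen (A : Set Seq) (n : ℕ) : Set (List Bool) :=
  {w | w.length = n ∧ w ∈ Lang A}

/-- Topological transitivity of a subshift, phrased via its language. -/
def TransitiveShift (A : Set Seq) : Prop :=
  ∀ u ∈ Lang A, ∀ v ∈ Lang A, ∃ t ∈ Lang A, u ++ t ++ v ∈ Lang A

/-- Cyclic rotation of a finite word. -/
def rot (w : List Bool) (k : ℕ) : List Bool := w.drop k ++ w.take k

/-- Lexicographic (dictionary) order on finite words. -/
def listLe (u v : List Bool) : Prop := List.Lex (· < ·) u v ∨ u = v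

/-- w = 0-max_w : w starts with 0 and is the lexicographically largest
cyclic permutation of itself starting with 0. -/
def isZeroMax (w : List Bool) : Prop :=
  w.headD true = false ∧
    ∀ k, k < w.length → (rot w k).headD true = false → listLe (rot w k) w

/-- w = 1-min_w : w starts with 1 and is the lexicographically smallest
cyclic permutation of itself starting with 1. -/
def isOneMin (w : List Bool) : Prop :=
  w.headD false = true ∧
    ∀ k, k < w.length → (rot w k).headD false = true → listLe w (rot w k)

/-- v is the 0-max cyclic permutation of w. -/
def isZeroMaxOf (v w : List Bool) : Prop :=
  (∃ k, k < w.length ∧ v = rot w k) ∧ v.headD true = false ∧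
    ∀ k, k < w.length → (rot w k).headD true = false → listLe (rot w k) v

/-- u is the 1-min cyclic permutation of w. -/
def isOneMinOf (u w : List Bool) : Prop :=
  (∃ k, k < w.length ∧ u = rot w k) ∧ u.headD false = true ∧
    ∀ k, k < w.length → (rot w k).headD false = true → listLe u (rot w k)

/-- The periodic sequence w^∞. -/
def periodicSeq (w : List Bool) : Seq := fun i => w.getD (i % w.length) false

/-- The sequence w followed by x. -/
def wordThen (w : List Bool) (x : Seq) : Seq :=
  fun i => if i < w.length then w.getD i false else x (i - w.length)

/-- Prepend one symbol to a sequence (e.g. 0α, 1β). -/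
def consSeq (a : Bool) (x : Seq) : Seq := fun i => if i = 0 then a else x (i - 1)

/-- A word is balanced if any two factors of equal length have numbers of 1's
differing by at most one. -/
def balanced (w : List Bool) : Prop :=
  ∀ u v : List Bool, u <:+: w → v <:+: w → u.length = v.length →
    ((u.count true : ℤ) - (v.count true : ℤ)).natAbs ≤ 1

/-- A word is cyclically balanced if its square is balanced. -/
def cycBalanced (w : List Bool) : Prop := balanced (w ++ w)

/-- Infinite concatenation of a sequence of (nonempty) finite words. -/
noncomputable def concatSeq (b : ℕ → List Bool) : Seq := fun i =>
  (b (sInf {n : ℕ | i < ∑ k ∈ Finset.range (n + 1), (b k).length})).getD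
    (i - ∑ k ∈ Finset.range (sInf {n : ℕ | i < ∑ k ∈ Finset.range (n + 1), (b k).length}), (b k).length)
    false

/-- (α,β) is renormalisable by the finite words ω and ν:
ω = 0-max_ω, ν = 1-min_ν, (0-max_ν)^∞ ≺ ω^∞, ν^∞ ≺ (1-min_ω)^∞, ℓ(ων) ≥ 3, and
0α = ω ν^{n₁^ν} ω^{n₁^ω} ν^{n₂^ν} ⋯ and 1β = ν ω^{m₁^ω} ν^{m₁^ν} ⋯ with all
exponents in ℕ ∪ {∞}; equivalently 0α (resp. 1β) is an infinite concatenation of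
copies of ω and ν whose first two blocks are ω, ν (resp. ν, ω). -/
def RenormalisableBy (α β : Seq) (ω ν : List Bool) : Prop :=
  isZeroMax ω ∧ isOneMin ν ∧
  (∀ v, isZeroMaxOf v ν → lexLt (periodicSeq v) (periodicSeq ω)) ∧
  (∀ u, isOneMinOf u ω → lexLt (periodicSeq ν) (periodicSeq u)) ∧
  3 ≤ ω.length + ν.length ∧
  (∃ b : ℕ → List Bool, b 0 = ω ∧ b 1 = ν ∧ (∀ k, b k = ω ∨ b k = ν) ∧
    consSeq false α = concatSeq b) ∧
  (∃ c : ℕ → List Bool, c 0 = ν ∧ c 1 = ω ∧ (∀ k, c k = ω ∨ c k = ν) ∧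
    consSeq true β = concatSeq c)

/-- (α,β) is renormalisable by an infinite sequence: either 0α = ω and 1β = νω
with ω infinite and ν = 1-min_ν finite, or 0α = ων and 1β = ν with ν infinite
and ω = 0-max_ω finite. -/
def RenormInfBy (α β : Seq) : Prop :=
  (∃ ν : List Bool, isOneMin ν ∧ consSeq true β = wordThen ν (consSeq false α)) ∨
  (∃ ω : List Bool, isZeroMax ω ∧ consSeq false α = wordThen ω (consSeq true β))

/-- n_α = min{n ≥ 1 : σⁿα ≻ α}. -/
noncomputable def nAlpha (α : Seq) : ℕ := sInf {n | 1 ≤ n ∧ lexLt α (shift^[n] α)}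

/-- The periodic sequence (α₁ ⋯ α_{n-1} 0)^∞. -/
def cutZero (α : Seq) (n : ℕ) : Seq :=
  fun i => if i % n = n - 1 then false else α (i % n)

/-- The periodic sequence (β₁ ⋯ β_{n-1} 1)^∞. -/
def cutOne (β : Seq) (n : ℕ) : Seq :=
  fun i => if i % n = n - 1 then true else β (i % n)

open Classical in
/-- The map ς : Σ₂¹ → Σ₂¹. -/
noncomputable def varsigma (α : Seq) : Seq :=
  if α ∈ ParryP then α else cutZero α (nAlpha α)

/-- The map ς' : Σ₂⁰ → Σ₂⁰, ς'(β) = mirror of ς(β̄). -/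
noncomputable def varsigma' (β : Seq) : Seq := mirror (varsigma (mirror β))

/-- M_α(β) = min{m ≥ 1 : σ^m β ≻ α}. -/
noncomputable def Msub (α β : Seq) : ℕ := sInf {m | 1 ≤ m ∧ lexLt α (shift^[m] β)}

/-- N_β(α) = min{n ≥ 1 : σⁿ α ≺ β}. -/
noncomputable def Nsub (α β : Seq) : ℕ := sInf {n | 1 ≤ n ∧ lexLt (shift^[n] α) β}

/-- ι(α) = (α₁ ⋯ α_{N_β(α)-1} 0)^∞. -/
noncomputable def iotaA (α β : Seq) : Seq := cutZero α (Nsub α β)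

/-- ι(β) = (β₁ ⋯ β_{M_α(β)-1} 1)^∞. -/
noncomputable def iotaB (α β : Seq) : Seq := cutOne β (Msub α β)

/-- ξ_α(β) = (β₁ ⋯ β_{M-1} 1)^∞ with M = M_α(β). -/
noncomputable def xiA (α β : Seq) : Seq := cutOne β (Msub α β)

/-- ξ'_β(α) = (α₁ ⋯ α_{N-1} 0)^∞ with N = N_β(α). -/
noncomputable def xiB (α β : Seq) : Seq := cutZero α (Nsub α β)

/-- A two sided extremal pair. -/
def twoSidedExtremal (α β : Seq) : Prop :=
  (∃ n, 1 ≤ n ∧ lexLt α (shift^[n] β)) ∧ (∃ m, 1 ≤ m ∧ lexLt (shift^[m] α) β)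

/-- A right extremal pair. -/
def rightExtremal (α β : Seq) : Prop :=
  (∀ m, 1 ≤ m → lexLt β (shift^[m] α)) ∧ (∃ n, 1 ≤ n ∧ lexLt α (shift^[n] β))

/-- A left extremal pair. -/
def leftExtremal (α β : Seq) : Prop :=
  (∀ n, 1 ≤ n → lexLt (shift^[n] β) α) ∧ (∃ m, 1 ≤ m ∧ lexLt (shift^[m] α) β)

/-- Dyadic rationals. -/
def IsDyadic (t : ℝ) : Prop := ∃ (z : ℤ) (n : ℕ), t = (z : ℝ) / 2 ^ n

/-- α₁ ⋯ α_n 1^∞. -/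
def onesAfter (α : Seq) (n : ℕ) : Seq := fun i => if i < n then α i else true

end DoublingHole

namespace DoublingHole

/-! ### The lexicographic order -/

theorem shift_iterate_apply (n : ℕ) (x : Seq) (i : ℕ) : shift^[n] x i = x (i + n) := by
  induction n generalizing x with
  | zero => rfl
  | succ n ih => rw [Function.iterate_succ_apply, ih]; rfl

theorem lexLt.trans {x y z : Seq} (h₁ : lexLt x y) (h₂ : lexLt y z) : lexLt x z := by
  obtain ⟨j, hj, hj'⟩ := h₁
  obtain ⟨k, hk, hk'⟩ := h₂
  rcases lt_trichotomy j k with h | h | h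
  · exact ⟨j, fun i hi => (hj i hi).trans (hk i (hi.trans h)), hk j h ▸ hj'⟩
  · subst h
    exact ⟨j, fun i hi => (hj i hi).trans (hk i hi), hj'.trans hk'⟩
  · exact ⟨k, fun i hi => (hj i (hi.trans h)).trans (hk i hi), (hj k h).symm ▸ hk'⟩

theorem lexLt_irrefl (x : Seq) : ¬ lexLt x x := fun ⟨_, _, h⟩ => lt_irrefl _ h

theorem lexLe.trans_lt {x y z : Seq} (h₁ : lexLe x y) (h₂ : lexLt y z) : lexLt x z := by
  rcases h₁ with h | rfl
  · exact h.trans h₂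
  · exact h₂

theorem lexLt.trans_le {x y z : Seq} (h₁ : lexLt x y) (h₂ : lexLe y z) : lexLt x z := by
  rcases h₂ with h | rfl
  · exact h₁.trans h
  · exact h₁

theorem lexLe.not_lt {x y : Seq} (h : lexLe x y) : ¬ lexLt y x :=
  fun h' => lexLt_irrefl x (h.trans_lt h')

theorem lexLe_or_lexLt (x y : Seq) : lexLe x y ∨ lexLt y x := by
  by_cases h : ∃ k, x k ≠ y k
  · classical
    have hmin : ∀ i, i < Nat.find h → x i = y i := fun i hi => not_not.1 (Nat.find_min h hi)
    rcases lt_or_gt_of_ne (Nat.find_spec h) with hlt | hgt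
    · exact Or.inl (Or.inl ⟨_, hmin, hlt⟩)
    · exact Or.inr ⟨_, fun i hi => (hmin i hi).symm, hgt⟩
  · push Not at h
    exact Or.inl (Or.inr (funext h))

theorem lexLt_of_shift_iterate {x y : Seq} (n : ℕ) (hxy : ∀ i, i < n → x i = y i)
    (h : lexLt (shift^[n] x) (shift^[n] y)) : lexLt x y := by
  obtain ⟨k, hk, hk'⟩ := h
  simp only [shift_iterate_apply] at hk hk'
  refine ⟨k + n, fun i hi => ?_, hk'⟩
  rcases lt_or_ge i n with hin | hin
  · exact hxy i hin
  · simpa [Nat.sub_add_cancel hin] using hk (i - n) (by omega)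

theorem shift_iterate_mem_lexSubshift {α β x : Seq} (hx : x ∈ lexSubshift α β) (n : ℕ) :
    shift^[n] x ∈ lexSubshift α β := fun m => by
  rw [← Function.iterate_add_apply]
  exact hx (m + n)

/-! ### Cutting the lower bound -/

theorem cutOne_apply_of_lt {β : Seq} {n i : ℕ} (h : i + 1 < n) : cutOne β n i = β i := by
  simp [cutOne, Nat.mod_eq_of_lt (show i < n by omega), show i ≠ n - 1 by omega]

theorem cutOne_apply_sub_one (β : Seq) {n : ℕ} (hn : 1 ≤ n) : cutOne β n (n - 1) = true := by
  simp [cutOne, Nat.mod_eq_of_lt (show n - 1 < n by omega)]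

theorem cutOne_add_self (β : Seq) (n i : ℕ) : cutOne β n (i + n) = cutOne β n i := by
  simp [cutOne]

theorem lexLt_cutOne {β : Seq} {n : ℕ} (hn : 1 ≤ n) (h : β (n - 1) = false) :
    lexLt β (cutOne β n) :=
  ⟨n - 1, fun i hi => (cutOne_apply_of_lt (by omega)).symm, by
    rw [h, cutOne_apply_sub_one β hn]; decide⟩

theorem cutOne_lexLe_of_mem {α β y : Seq} {n : ℕ} (hn : 1 ≤ n) (h : β (n - 1) = false)
    (hlt : lexLt α (shift^[n] β)) (hy : y ∈ lexSubshift α β) : lexLe (cutOne β n) y := by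
  refine (lexLe_or_lexLt _ _).resolve_right ?_
  rintro ⟨k, hk, hk'⟩
  induction k using Nat.strong_induction_on generalizing y with
  | _ k ih =>
    have hβy : lexLe β y := (hy 0).1
    rcases lt_trichotomy (k + 1) n with hkn | hkn | hkn
    · refine hβy.not_lt ⟨k, fun i hi => ?_, ?_⟩
      · rw [hk i hi, cutOne_apply_of_lt (by omega)]
      · rwa [cutOne_apply_of_lt hkn] at hk'
    · refine hβy.not_lt (lexLt_of_shift_iterate n (fun i hi => ?_) ((hy n).2.trans_lt hlt))
      rcases eq_or_ne i k with rfl | hik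
      · rw [show i = n - 1 by omega] at hk' ⊢
        rw [h]
        exact Bool.eq_false_of_not_eq_true fun hc => by
          rw [hc] at hk'
          exact absurd hk' (by cases cutOne β n (n - 1) <;> decide)
      · rw [hk i (by omega), cutOne_apply_of_lt (by omega)]
    · refine ih (k - n) (by omega) (shift_iterate_mem_lexSubshift hy n) (fun i hi => ?_) ?_
      · rw [shift_iterate_apply, hk _ (by omega), cutOne_add_self]
      · rw [shift_iterate_apply, ← cutOne_add_self, Nat.sub_add_cancel (by omega)]
        exact hk'

theorem apply_Msub_sub_one {α β : Seq} (hα : α ∈ ParryP) (hβ : β 0 = false)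
    (hlt : lexLt α (shift^[Msub α β] β)) : β (Msub α β - 1) = false := by
  by_contra hc
  rw [Bool.not_eq_false] at hc
  have hM : Msub α β - 1 ≠ 0 := fun h0 => by simp [h0, hβ] at hc
  refine Nat.notMem_of_lt_sInf (show Msub α β - 1 < Msub α β by omega)
    ⟨Nat.one_le_iff_ne_zero.2 hM, lexLt_of_shift_iterate 1 (fun i hi => ?_) ?_⟩
  · obtain rfl : i = 0 := by omega
    rw [shift_iterate_apply, zero_add, hα.1, hc]
  · rw [← Function.iterate_add_apply, show 1 + (Msub α β - 1) = Msub α β by omega]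
    exact (hα.2 1 le_rfl).trans_lt hlt

theorem lexSubshift_eq_lexSubshift_xiA {α β : Seq} (hα : α ∈ ParryP) (hβ : β 0 = false)
    (hex : ∃ n, 1 ≤ n ∧ lexLt α (shift^[n] β)) :
    lexSubshift α β = lexSubshift α (xiA α β) := by
  obtain ⟨hM, hlt⟩ : 1 ≤ Msub α β ∧ lexLt α (shift^[Msub α β] β) := Nat.sInf_mem hex
  have hzero := apply_Msub_sub_one hα hβ hlt
  refine Set.Subset.antisymm (fun x hx n => ⟨?_, (hx n).2⟩) (fun x hx n => ⟨?_, (hx n).2⟩)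
  · exact cutOne_lexLe_of_mem hM hzero hlt (shift_iterate_mem_lexSubshift hx n)
  · exact Or.inl ((lexLt_cutOne hM hzero).trans_le (hx n).1)

/-! ### Mirror symmetry -/

theorem mirror_mirror (x : Seq) : mirror (mirror x) = x := by
  funext i
  simp [mirror]

theorem shift_iterate_mirror (n : ℕ) (x : Seq) :
    shift^[n] (mirror x) = mirror (shift^[n] x) := by
  funext i
  simp [shift_iterate_apply, mirror]

theorem lexLt.mirror {x y : Seq} (h : lexLt x y) : lexLt (mirror y) (mirror x) := by
  obtain ⟨k, hk, hk'⟩ := h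
  refine ⟨k, fun i hi => by simp [DoublingHole.mirror, hk i hi], ?_⟩
  revert hk'
  simp only [DoublingHole.mirror]
  cases x k <;> cases y k <;> decide

theorem lexLt_mirror {x y : Seq} : lexLt (mirror x) (mirror y) ↔ lexLt y x :=
  ⟨fun h => by simpa only [mirror_mirror] using h.mirror, lexLt.mirror⟩

theorem lexLe_mirror {x y : Seq} : lexLe (mirror x) (mirror y) ↔ lexLe y x :=
  or_congr lexLt_mirror
    ⟨fun h => by rw [← mirror_mirror x, h, mirror_mirror], fun h => by rw [h]⟩

theorem mirror_mem_lexSubshift {α β x : Seq} :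
    mirror x ∈ lexSubshift (mirror β) (mirror α) ↔ x ∈ lexSubshift α β :=
  forall_congr' fun n => by
    rw [shift_iterate_mirror, lexLe_mirror, lexLe_mirror, and_comm]

theorem mirror_cutZero (α : Seq) (n : ℕ) : mirror (cutZero α n) = cutOne (mirror α) n := by
  funext i
  simp only [mirror, cutZero, cutOne]
  split_ifs <;> rfl

theorem mirror_xiB (α β : Seq) : mirror (xiB α β) = xiA (mirror β) (mirror α) := by
  simp only [xiA, xiB, mirror_cutZero, Msub, Nsub, shift_iterate_mirror, lexLt_mirror]

/-- for (α,β) ∈ P × P̄, (i) if (α,β) is right extremal then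
Σ_{(α,β)} = Σ_{(α, ξ_α(β))}; (ii) if (α,β) is left extremal then
Σ_{(α,β)} = Σ_{(ξ'_β(α), β)}. -/
theorem statement13 (α β : Seq) (hα : α ∈ ParryP) (hβ : β ∈ barP) :
    (rightExtremal α β → lexSubshift α β = lexSubshift α (xiA α β)) ∧
    (leftExtremal α β → lexSubshift α β = lexSubshift (xiB α β) β) := by
  refine ⟨fun h => lexSubshift_eq_lexSubshift_xiA hα ?_ h.2, fun h => ?_⟩
  · simpa [mirror] using hβ.1
  · have hex : ∃ n, 1 ≤ n ∧ lexLt (mirror β) (shift^[n] (mirror α)) := by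
      simpa only [shift_iterate_mirror, lexLt_mirror] using h.2
    have key := lexSubshift_eq_lexSubshift_xiA hβ (by simp [mirror, hα.1]) hex
    ext x
    rw [← mirror_mem_lexSubshift, key, ← mirror_xiB, mirror_mem_lexSubshift]

end DoublingHole
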